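/- Let n ≥ 1, p ≥ 1, and let s > 2 satisfy (n−2)s < 2n. Then there exists a constant C > 0 (depending only on n, p, s) such that for every R > 0, every r ≥ 1, every t > 1, and every positive function u ∈ C⁰(cl(B_R) × [0,∞)) ∩ C^{2,1}(B_R × (0,∞)) that solves ∂_t u = u^p Δu in B_R × (0,∞), vanishes on ∂B_R × (0,∞), and satisfies the semi-convexity inequality ∂_t u(x,t) ≥ −u(x,t)/(p t) for all x ∈ B_R and t > 0, one has ‖u(·,t)‖_{L^{(p+r)s/2}(B_R)} ≤ (C r / t)^{a/(p+r)} · ‖u(·,t)‖_{L^r(B_R)}^{1 − pa/(p+r)}, where a = a(r) := (n(p+r)/(2r) − n/s) / (1 − n/2 + n(p+r)/(2r)) ∈ (0,1). -/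

import Mathlib

open MeasureTheory
open scoped ENNReal
noncomputable section

abbrev Euc (n : ℕ) := EuclideanSpace ℝ (Fin n)

/-- The Laplacian (in the spatial variables) of `f : ℝⁿ → ℝ`, as the sum of the
second partial derivatives. -/
def lap (n : ℕ) (f : Euc n → ℝ) (x : Euc n) : ℝ :=
  ∑ i : Fin n, iteratedFDeriv ℝ 2 f x ![EuclideanSpace.single i 1, EuclideanSpace.single i 1]

/-- The squared length of the gradient of `f`. -/
def gradSq (n : ℕ) (f : Euc n → ℝ) (x : Euc n) : ℝ :=
  ∑ i : Fin n, (fderiv ℝ f x (EuclideanSpace.single i 1)) ^ 2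

theorem gradSq_nonneg (n : ℕ) (f : Euc n → ℝ) (x : Euc n) : 0 ≤ gradSq n f x :=
  Finset.sum_nonneg fun _ _ => sq_nonneg _

theorem norm_fderiv_le_sqrt_gradSq (n : ℕ) (f : Euc n → ℝ) (x : Euc n) :
    ‖fderiv ℝ f x‖ ≤ √(gradSq n f x) := by
  refine ContinuousLinearMap.opNorm_le_bound _ (Real.sqrt_nonneg _) fun y => ?_
  have hy : y = ∑ i : Fin n, y i • EuclideanSpace.single i (1 : ℝ) := by
    ext j
    simp [Finset.sum_apply, Pi.single_apply]
  have h1 : fderiv ℝ f x y = ∑ i : Fin n, fderiv ℝ f x (EuclideanSpace.single i 1) * y i := by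
    conv_lhs => rw [hy]
    simp [mul_comm]
  rw [h1, EuclideanSpace.norm_eq, Real.norm_eq_abs]
  refine abs_le.2 ⟨?_, ?_⟩
  · have := Real.sum_mul_le_sqrt_mul_sqrt Finset.univ
      (fun i : Fin n => - fderiv ℝ f x (EuclideanSpace.single i 1)) (fun i => y i)
    simp only [neg_mul, Finset.sum_neg_distrib, neg_sq] at this
    simp only [gradSq, Real.norm_eq_abs, sq_abs]
    linarith
  · simpa [gradSq] using Real.sum_mul_le_sqrt_mul_sqrt Finset.univ
      (fun i : Fin n => fderiv ℝ f x (EuclideanSpace.single i 1)) (fun i => y i)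

theorem isCompact_superlevel {n : ℕ} {R ε : ℝ} {v : Euc n → ℝ} (hε : 0 < ε)
    (hvc : ContinuousOn v (Metric.closedBall 0 R)) (hv0 : ∀ x ∈ Metric.sphere (0 : Euc n) R, v x = 0) :
    IsCompact {x ∈ Metric.ball (0 : Euc n) R | ε ≤ v x} := by
  have : {x ∈ Metric.ball (0 : Euc n) R | ε ≤ v x} =
      Metric.closedBall (0 : Euc n) R ∩ v ⁻¹' Set.Ici ε := by
    ext x
    simp only [Set.mem_ofPred_eq, Set.mem_inter_iff, Set.mem_preimage, Set.mem_Ici]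
    constructor
    · rintro ⟨h1, h2⟩
      exact ⟨Metric.ball_subset_closedBall h1, h2⟩
    · rintro ⟨h1, h2⟩
      refine ⟨?_, h2⟩
      by_contra h
      have : x ∈ Metric.sphere (0 : Euc n) R := by
        rw [Metric.mem_sphere]
        exact le_antisymm h1 (not_lt.1 h)
      linarith [hv0 x this]
  rw [this]
  exact (isCompact_closedBall _ _).of_isClosed_subset
    (hvc.preimage_isClosed_of_isClosed Metric.isClosed_closedBall isClosed_Ici)
    Set.inter_subset_left

/-- A `C¹` function on the ball which vanishes where `v < ε` extends by zero to a compactly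
supported `C¹` function on the whole space. -/
theorem contDiff_indicator_ball {n : ℕ} {R ε : ℝ} {v g : Euc n → ℝ} (hε : 0 < ε)
    (hvc : ContinuousOn v (Metric.closedBall 0 R)) (hv0 : ∀ x ∈ Metric.sphere (0 : Euc n) R, v x = 0)
    (hg : ContDiffOn ℝ 1 g (Metric.ball 0 R))
    (hg0 : ∀ x ∈ Metric.ball (0 : Euc n) R, v x < ε → g x = 0) :
    ContDiff ℝ 1 ((Metric.ball (0 : Euc n) R).indicator g) ∧
      HasCompactSupport ((Metric.ball (0 : Euc n) R).indicator g) := by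
  have hK := isCompact_superlevel hε hvc hv0
  have hsub : Function.support ((Metric.ball (0 : Euc n) R).indicator g) ⊆
      {x ∈ Metric.ball (0 : Euc n) R | ε ≤ v x} := by
    intro x hx
    rw [Function.mem_support] at hx
    have hxb : x ∈ Metric.ball (0 : Euc n) R := by
      by_contra h
      exact hx (Set.indicator_of_notMem h _)
    rw [Set.indicator_of_mem hxb] at hx
    refine ⟨hxb, ?_⟩
    by_contra! h
    exact hx (hg0 x hxb h)
  refine ⟨contDiff_iff_contDiffAt.2 fun x => ?_,
    HasCompactSupport.of_support_subset_isCompact hK hsub⟩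
  by_cases hx : x ∈ {x ∈ Metric.ball (0 : Euc n) R | ε ≤ v x}
  · refine (hg.contDiffAt (Metric.isOpen_ball.mem_nhds hx.1)).congr_of_eventuallyEq ?_
    filter_upwards [Metric.isOpen_ball.mem_nhds hx.1] with y hy
    exact Set.indicator_of_mem hy _
  · refine (contDiffAt_const (c := (0 : ℝ))).congr_of_eventuallyEq ?_
    filter_upwards [hK.isClosed.isOpen_compl.mem_nhds hx] with y hy
    exact Function.notMem_support.1 fun h => hy (hsub h)

theorem integral_fderiv_apply_eq_zero {n : ℕ} {h : Euc n → ℝ} (hh : ContDiff ℝ 1 h)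
    (hc : HasCompactSupport h) (e : Euc n) : ∫ x, fderiv ℝ h x e = 0 := by
  have hd : Continuous fun x => fderiv ℝ h x e :=
    (hh.continuous_fderiv (by norm_num)).clm_apply continuous_const
  have hcd : HasCompactSupport fun x => fderiv ℝ h x e := hc.fderiv_apply (𝕜 := ℝ) e
  have := integral_bilinear_hasLineDerivAt_right_eq_neg_left_of_integrable
    (μ := (volume : Measure (Euc n)))
    (f := fun _ : Euc n => (1 : ℝ)) (f' := fun _ => 0) (g := h) (g' := fun x => fderiv ℝ h x e)
    (v := e) (B := ContinuousLinearMap.mul ℝ ℝ) (by simp)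
    (by simpa using hd.integrable_of_hasCompactSupport hcd)
    (by simpa using hh.continuous.integrable_of_hasCompactSupport hc)
    (fun x _ => by simpa using (hasFDerivAt_const (1 : ℝ) x).hasLineDerivAt e)
    (fun x _ => ((hh.differentiable (by norm_num)) x).hasFDerivAt.hasLineDerivAt e)
  simpa using this

theorem hasDerivAt_max_zero_rpow {β : ℝ} (hβ : 1 < β) (y : ℝ) :
    HasDerivAt (fun y : ℝ => max y 0 ^ β) (β * max y 0 ^ (β - 1)) y := by
  have hne : ∀ y : ℝ, y ≠ 0 → HasDerivAt (fun y : ℝ => max y 0 ^ β) (β * max y 0 ^ (β - 1)) y := by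
    intro y hy
    rcases hy.lt_or_gt with h | h
    · rw [max_eq_right h.le, Real.zero_rpow (by linarith), mul_zero]
      refine (hasDerivAt_const y (0 : ℝ)).congr_of_eventuallyEq ?_
      filter_upwards [gt_mem_nhds h] with z hz
      rw [max_eq_right hz.le, Real.zero_rpow (by linarith)]
    · rw [max_eq_left h.le]
      refine (Real.hasDerivAt_rpow_const (Or.inl hy)).congr_of_eventuallyEq ?_
      filter_upwards [lt_mem_nhds h] with z hz
      rw [max_eq_left hz.le]
  have hc : ∀ b : ℝ, 0 < b → Continuous fun y : ℝ => max y 0 ^ b := fun b hb =>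
    (continuous_id.max continuous_const).rpow_const fun _ => Or.inr hb.le
  rcases eq_or_ne y 0 with rfl | hy
  · exact hasDerivAt_of_hasDerivAt_of_ne (fun y hy => hne y hy)
      (hc β (by linarith)).continuousAt
      ((hc (β - 1) (by linarith)).const_mul β).continuousAt
  · exact hne y hy

theorem contDiff_max_zero_rpow {β : ℝ} (hβ : 1 < β) :
    ContDiff ℝ 1 fun y : ℝ => max y 0 ^ β := by
  rw [contDiff_one_iff_deriv]
  refine ⟨fun y => (hasDerivAt_max_zero_rpow hβ y).differentiableAt, ?_⟩
  rw [show deriv (fun y : ℝ => max y 0 ^ β) = fun y => β * max y 0 ^ (β - 1) from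
    funext fun y => (hasDerivAt_max_zero_rpow hβ y).deriv]
  exact ((continuous_id.max continuous_const).rpow_const fun _ => Or.inr (by linarith)).const_mul β

theorem hasFDerivAt_indicator_ball {n : ℕ} {R : ℝ} {g : Euc n → ℝ} {g' : Euc n →L[ℝ] ℝ} {x : Euc n}
    (hx : x ∈ Metric.ball (0 : Euc n) R) (hg : HasFDerivAt g g' x) :
    HasFDerivAt ((Metric.ball (0 : Euc n) R).indicator g) g' x := by
  refine hg.congr_of_eventuallyEq ?_
  filter_upwards [Metric.isOpen_ball.mem_nhds hx] with y hy
  exact Set.indicator_of_mem hy _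

theorem fderiv_eq_zero_of_notMem {n : ℕ} {h : Euc n → ℝ}
    {U : Set (Euc n)} (hU : IsClosed U) (h0 : ∀ x ∉ U, h x = 0) {x : Euc n} (hx : x ∉ U) :
    fderiv ℝ h x = 0 := by
  have : h =ᶠ[nhds x] fun _ => 0 := by
    filter_upwards [hU.isOpen_compl.mem_nhds hx] with y hy using h0 y hy
  rw [this.fderiv_eq]
  simp

theorem lintegral_gradSq_le {n : ℕ} {R ε p r c : ℝ} {v : Euc n → ℝ} (hε : 0 < ε)
    (hp : 1 ≤ p) (hr : 1 ≤ r) (hc : 0 ≤ c)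
    (hvc : ContinuousOn v (Metric.closedBall 0 R))
    (hv2 : ContDiffOn ℝ 2 v (Metric.ball 0 R))
    (hpos : ∀ x ∈ Metric.ball (0 : Euc n) R, 0 < v x)
    (hv0 : ∀ x ∈ Metric.sphere (0 : Euc n) R, v x = 0)
    (hlap : ∀ x ∈ Metric.ball (0 : Euc n) R, -(c * v x) ≤ v x ^ p * lap n v x) :
    ∫⁻ x in {x ∈ Metric.ball (0 : Euc n) R | ε ≤ v x},
        ENNReal.ofReal ((p + r - 1) * v x ^ (p + r - 2) * gradSq n v x) ≤
      ∫⁻ x in Metric.ball (0 : Euc n) R, ENNReal.ofReal (c * v x ^ r) := by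
  set B := Metric.ball (0 : Euc n) R with hB
  set m := p + r - 1 with hm
  have hm1 : 1 ≤ m := by linarith
  let e : Fin n → Euc n := fun i => EuclideanSpace.single i 1
  let η : ℝ → ℝ := fun y => Real.smoothTransition ((y - ε / 2) / (ε / 2))
  have hηC : ContDiff ℝ 1 η :=
    (Real.smoothTransition.contDiff (n := 1)).comp ((contDiff_id.sub contDiff_const).div_const _)
  have hηmono : Monotone η := fun a b hab =>
    Real.smoothTransition.monotone (by gcongr)
  have hη0 : ∀ y, 0 ≤ η y := fun y => Real.smoothTransition.nonneg _
  have hη1 : ∀ y, η y ≤ 1 := fun y => Real.smoothTransition.le_one _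
  have hηz : ∀ y, y < ε / 2 → η y = 0 := fun y hy =>
    Real.smoothTransition.zero_of_nonpos (div_nonpos_of_nonpos_of_nonneg (by linarith) (by linarith))
  have hηo : ∀ y, ε ≤ y → η y = 1 := fun y hy =>
    Real.smoothTransition.one_of_one_le (by rw [le_div_iff₀ (by linarith)]; linarith)
  let ψ : ℝ → ℝ := fun y => y ^ m * η y
  have hψC : ContDiff ℝ 1 ψ :=
    (by simpa using Real.contDiff_rpow_const_of_le (p := m) (n := 1) (by simpa using hm1)
      : ContDiff ℝ 1 fun y : ℝ => y ^ m).mul hηC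
  have hψ' : ∀ y : ℝ, 0 < y → m * y ^ (m - 1) * η y ≤ deriv ψ y := by
    intro y hy
    have h1 : HasDerivAt ψ (m * y ^ (m - 1) * η y + y ^ m * deriv η y) y :=
      (Real.hasDerivAt_rpow_const (Or.inr hm1)).mul
        ((hηC.differentiable (by norm_num)) y).hasDerivAt
    rw [h1.deriv]
    have : 0 ≤ deriv η y := hηmono.deriv_nonneg
    have : 0 ≤ y ^ m * deriv η y := by positivity
    linarith
  have hv1 : ContDiffOn ℝ 1 (fderiv ℝ v) B :=
    hv2.fderiv_of_isOpen Metric.isOpen_ball (by norm_num)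
  let g : Fin n → Euc n → ℝ := fun i x => ψ (v x) * fderiv ℝ v x (e i)
  let h : Fin n → Euc n → ℝ := fun i => B.indicator (g i)
  have hh : ∀ i, ContDiff ℝ 1 (h i) ∧ HasCompactSupport (h i) := fun i => by
    refine contDiff_indicator_ball (half_pos hε) hvc hv0 ?_ ?_
    · exact (hψC.comp_contDiffOn (hv2.of_le (by norm_num))).mul
        (hv1.clm_apply contDiffOn_const)
    · intro x _ hx
      simp [g, ψ, hηz _ hx]
  let H : Euc n → ℝ := fun x => ∑ i, fderiv ℝ (h i) x (e i)
  have hHi : ∀ i, Integrable fun x => fderiv ℝ (h i) x (e i) := fun i =>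
    Continuous.integrable_of_hasCompactSupport
      (((hh i).1.continuous_fderiv (by norm_num)).clm_apply continuous_const)
      ((hh i).2.fderiv_apply (𝕜 := ℝ) (e i))
  have hHint : Integrable H := integrable_finsetSum _ fun i _ => hHi i
  have hH0 : ∫ x, H x = 0 := by
    rw [integral_finsetSum _ fun i _ => hHi i]
    exact Finset.sum_eq_zero fun i _ => integral_fderiv_apply_eq_zero (hh i).1 (hh i).2 _
  have hHB : ∀ x ∈ B, H x = deriv ψ (v x) * gradSq n v x + ψ (v x) * lap n v x := by
    intro x hx
    have hvx : HasFDerivAt v (fderiv ℝ v x) x :=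
      ((hv2.contDiffAt (Metric.isOpen_ball.mem_nhds hx)).differentiableAt (by norm_num)).hasFDerivAt
    have hdx : HasFDerivAt (fderiv ℝ v) (fderiv ℝ (fderiv ℝ v) x) x :=
      ((hv1.contDiffAt (Metric.isOpen_ball.mem_nhds hx)).differentiableAt (by norm_num)).hasFDerivAt
    have hψx : HasFDerivAt (fun y => ψ (v y)) (deriv ψ (v x) • fderiv ℝ v x) x :=
      ((hψC.differentiable (by norm_num)) (v x)).hasDerivAt.comp_hasFDerivAt x hvx
    simp only [H, gradSq, lap, Finset.mul_sum, ← Finset.sum_add_distrib]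
    refine Finset.sum_congr rfl fun i _ => ?_
    have hgi := hψx.mul (hdx.clm_apply (hasFDerivAt_const (e i) x))
    have hhi : fderiv ℝ (h i) x = _ := (hasFDerivAt_indicator_ball hx hgi).fderiv
    rw [hhi, iteratedFDeriv_two_apply]
    simp [e]
    ring
  have hHout : ∀ x ∉ B, H x = 0 := by
    intro x hx
    refine Finset.sum_eq_zero fun i _ => ?_
    have hK := isCompact_superlevel (half_pos hε) hvc hv0
    rw [fderiv_eq_zero_of_notMem hK.isClosed (fun y hy => ?_) (fun hx' => hx hx'.1)]
    · simp
    · by_cases hyB : y ∈ B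
      · have : v y < ε / 2 := by
          by_contra! hlt
          exact hy ⟨hyB, hlt⟩
        simp [h, hyB, g, ψ, hηz _ this]
      · simp [h, hyB]
  have hBi : Integrable (B.indicator fun x => c * v x ^ r) := by
    rw [integrable_indicator_iff Metric.isOpen_ball.measurableSet]
    have : ContinuousOn (fun x => c * v x ^ r) (Metric.closedBall (0 : Euc n) R) :=
      (hvc.rpow_const fun x _ => Or.inr (by linarith)).const_mul c |>.congr fun x _ => rfl
    exact (this.integrableOn_compact (isCompact_closedBall _ _)).mono_set
      Metric.ball_subset_closedBall
  have hKm : MeasurableSet {x ∈ B | ε ≤ v x} :=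
    (isCompact_superlevel hε hvc hv0).isClosed.measurableSet
  have hkey : ∀ x ∈ B, (m * v x ^ (p + r - 2) * gradSq n v x) * η (v x) ≤ H x + c * v x ^ r := by
    intro x hx
    have hvx := hpos x hx
    rw [hHB x hx]
    have h1 : m * v x ^ (p + r - 2) * gradSq n v x * η (v x) ≤ deriv ψ (v x) * gradSq n v x := by
      have := mul_le_mul_of_nonneg_right (hψ' _ hvx) (gradSq_nonneg n v x)
      rw [show m - 1 = p + r - 2 by rw [hm]; ring] at this
      linarith
    have h2 : -(c * v x ^ r) ≤ ψ (v x) * lap n v x := by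
      have e1 : v x ^ m = v x ^ (r - 1) * v x ^ p := by
        rw [← Real.rpow_add hvx]; congr 1; rw [hm]; ring
      have e2 : v x ^ r = v x ^ (r - 1) * v x := by
        rw [← Real.rpow_add_one hvx.ne']; congr 1; ring
      have h3 : ψ (v x) * lap n v x =
          η (v x) * v x ^ (r - 1) * (v x ^ p * lap n v x) := by
        simp only [ψ, e1]; ring
      have h4 := mul_le_mul_of_nonneg_left (hlap x hx)
        (mul_nonneg (hη0 (v x)) (Real.rpow_nonneg hvx.le (r - 1)))
      have h5 : η (v x) * (c * v x ^ r) ≤ 1 * (c * v x ^ r) :=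
        mul_le_mul_of_nonneg_right (hη1 _) (by positivity)
      rw [h3]
      rw [e2] at h5 ⊢
      linarith
    linarith
  have hnonneg : ∀ x, 0 ≤ H x + B.indicator (fun x => c * v x ^ r) x := by
    intro x
    by_cases hx : x ∈ B
    · rw [Set.indicator_of_mem hx]
      refine le_trans ?_ (hkey x hx)
      have := hpos x hx
      have := gradSq_nonneg n v x
      have := hη0 (v x)
      positivity
    · rw [Set.indicator_of_notMem hx, hHout x hx, add_zero]
  calc _ = ∫⁻ x, ({x ∈ B | ε ≤ v x}).indicator
          (fun x => ENNReal.ofReal (m * v x ^ (p + r - 2) * gradSq n v x)) x :=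
        (lintegral_indicator hKm _).symm
    _ ≤ ∫⁻ x, ENNReal.ofReal (H x + B.indicator (fun x => c * v x ^ r) x) := by
        refine lintegral_mono fun x => ?_
        by_cases hx : x ∈ {x ∈ B | ε ≤ v x}
        · simp only [Set.indicator_of_mem hx, Set.indicator_of_mem hx.1]
          refine ENNReal.ofReal_le_ofReal ?_
          simpa [hηo _ hx.2] using hkey x hx.1
        · rw [Set.indicator_of_notMem hx]
          exact zero_le
    _ = ENNReal.ofReal (∫ x, (H x + B.indicator (fun x => c * v x ^ r) x)) :=
        (ofReal_integral_eq_lintegral_ofReal (hHint.add hBi) (Filter.Eventually.of_forall hnonneg)).symm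
    _ = ENNReal.ofReal (∫ x, B.indicator (fun x => c * v x ^ r) x) := by
        rw [integral_add hHint hBi, hH0, zero_add]
    _ = ∫⁻ x in B, ENNReal.ofReal (c * v x ^ r) := by
        rw [integral_indicator Metric.isOpen_ball.measurableSet,
          ofReal_integral_eq_lintegral_ofReal]
        · exact (integrable_indicator_iff Metric.isOpen_ball.measurableSet).1 hBi
        · filter_upwards [ae_restrict_mem Metric.isOpen_ball.measurableSet] with x hx
          have := hpos x hx
          simp only [Pi.zero_apply]
          positivity

theorem enorm_le_lintegral_fderiv {f : Euc 1 → ℝ} (hf : ContDiff ℝ 1 f) (hc : HasCompactSupport f)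
    (x : Euc 1) : ‖f x‖ₑ ≤ ∫⁻ y, ‖fderiv ℝ f y‖ₑ := by
  let e : ℝ ≃ₗᵢ[ℝ] Euc 1 := (OrthonormalBasis.singleton (Fin 1) ℝ).repr
  have h1 := HasCompactSupport.enorm_le_lintegral_Ici_deriv
    (f := f ∘ e) (hf.comp e.contDiff) (hc.comp_homeomorph e.toHomeomorph) (e.symm x)
  have h2 : (f ∘ e) (e.symm x) = f x := by simp
  rw [h2] at h1
  calc ‖f x‖ₑ ≤ _ := h1
    _ ≤ ∫⁻ y, ‖deriv (f ∘ e) y‖ₑ := lintegral_mono' Measure.restrict_le_self le_rfl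
    _ ≤ ∫⁻ y, ‖fderiv ℝ f (e y)‖ₑ := by
        refine lintegral_mono fun y => ?_
        have h3 : HasDerivAt (f ∘ e) (fderiv ℝ f (e y) (e 1)) y :=
          ((hf.differentiable (by norm_num)) (e y)).hasFDerivAt.comp_hasDerivAt y
            (by simpa using (e.toContinuousLinearEquiv : ℝ →L[ℝ] Euc 1).hasDerivAt (x := y))
        rw [h3.deriv, ← ofReal_norm, ← ofReal_norm]
        refine ENNReal.ofReal_le_ofReal ?_
        simpa using (fderiv ℝ f (e y)).le_opNorm (e 1)
    _ = _ := e.measurePreserving.lintegral_comp_emb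
        e.toHomeomorph.measurableEmbedding (fun y => ‖fderiv ℝ f y‖ₑ)

/-- The truncated power `(v - ε)₊ ^ β` on the ball, extended by zero. -/
def truncPow (n : ℕ) (R ε β : ℝ) (v : Euc n → ℝ) : Euc n → ℝ :=
  (Metric.ball (0 : Euc n) R).indicator fun x => max (v x - ε) 0 ^ β

theorem contDiff_truncPow {n : ℕ} {R ε β : ℝ} {v : Euc n → ℝ} (hε : 0 < ε) (hβ : 1 < β)
    (hvc : ContinuousOn v (Metric.closedBall 0 R))
    (hv2 : ContDiffOn ℝ 2 v (Metric.ball 0 R))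
    (hv0 : ∀ x ∈ Metric.sphere (0 : Euc n) R, v x = 0) :
    ContDiff ℝ 1 (truncPow n R ε β v) ∧ HasCompactSupport (truncPow n R ε β v) := by
  refine contDiff_indicator_ball hε hvc hv0 ?_ fun x _ hx => ?_
  · exact (contDiff_max_zero_rpow hβ).comp_contDiffOn
      ((hv2.of_le (by norm_num)).sub contDiffOn_const)
  · rw [max_eq_right (by linarith), Real.zero_rpow (by linarith)]

theorem tendsto_truncPow {n : ℕ} {R β : ℝ} {v : Euc n → ℝ} (hβ : 1 < β) {x : Euc n}
    (hx : x ∈ Metric.ball (0 : Euc n) R) (hpos : 0 < v x) :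
    Filter.Tendsto (fun j : ℕ => ‖truncPow n R (1 / ((j : ℝ) + 1)) β v x‖ₑ) Filter.atTop
      (nhds (ENNReal.ofReal (v x) ^ β)) := by
  have h1 : Filter.Tendsto (fun j : ℕ => max (v x - 1 / ((j : ℝ) + 1)) 0 ^ β) Filter.atTop
      (nhds (max (v x - 0) 0 ^ β)) :=
    ((contDiff_max_zero_rpow hβ).continuous.tendsto (v x - 0)).comp
      (tendsto_const_nhds.sub tendsto_one_div_add_atTop_nhds_zero_nat)
  rw [sub_zero, max_eq_left hpos.le] at h1
  have h2 := h1.enorm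
  rw [Real.enorm_of_nonneg (by positivity),
    ← ENNReal.ofReal_rpow_of_pos hpos] at h2
  refine h2.congr fun j => ?_
  rw [truncPow, Set.indicator_of_mem hx]

theorem lintegral_fderiv_truncPow_le {n : ℕ} {R ε p r c k γ d : ℝ} {v : Euc n → ℝ} (hε : 0 < ε)
    (hp : 1 ≤ p) (hr : 1 ≤ r) (hc : 0 ≤ c) (hk : k = (p + r) / 2) (hγ : 2 ≤ γ)
    (hd : k ^ 2 * c ≤ (p + r - 1) * d)
    (hvc : ContinuousOn v (Metric.closedBall 0 R))
    (hv2 : ContDiffOn ℝ 2 v (Metric.ball 0 R))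
    (hpos : ∀ x ∈ Metric.ball (0 : Euc n) R, 0 < v x)
    (hv0 : ∀ x ∈ Metric.sphere (0 : Euc n) R, v x = 0)
    (hlap : ∀ x ∈ Metric.ball (0 : Euc n) R, -(c * v x) ≤ v x ^ p * lap n v x) :
    ∫⁻ x, ‖fderiv ℝ (truncPow n R ε (γ * k) v) x‖ₑ ≤
      ENNReal.ofReal γ *
        ((∫⁻ x in Metric.ball (0 : Euc n) R, ENNReal.ofReal (v x) ^ (k * (2 * γ - 2))) ^ (1 / 2 : ℝ) *
        (ENNReal.ofReal d *
          ∫⁻ x in Metric.ball (0 : Euc n) R, ENNReal.ofReal (v x) ^ r) ^ (1 / 2 : ℝ)) := by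
  set B := Metric.ball (0 : Euc n) R with hB
  have hk1 : 1 ≤ k := by linarith
  have hβ : 1 < γ * k := by nlinarith
  set K := {x ∈ B | ε ≤ v x} with hKdef
  have hKc : IsCompact K := isCompact_superlevel hε hvc hv0
  have hKB : K ⊆ B := fun x hx => hx.1
  let a : Euc n → ℝ≥0∞ := fun x => ENNReal.ofReal (v x) ^ (k * (γ - 1))
  let b : Euc n → ℝ≥0∞ := fun x => ENNReal.ofReal (k * v x ^ (k - 1) * √(gradSq n v x))
  have hpt : ∀ x ∈ K, ‖fderiv ℝ (truncPow n R ε (γ * k) v) x‖ₑ ≤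
      ENNReal.ofReal γ * (a * b) x := by
    intro x hx
    have hvx := hpos x hx.1
    have hdv : HasFDerivAt v (fderiv ℝ v x) x :=
      ((hv2.contDiffAt (Metric.isOpen_ball.mem_nhds hx.1)).differentiableAt
        (by norm_num)).hasFDerivAt
    have h1 := (hasDerivAt_max_zero_rpow hβ (v x - ε)).comp_hasFDerivAt x (hdv.sub_const ε)
    have h2 : fderiv ℝ (truncPow n R ε (γ * k) v) x = _ :=
      (hasFDerivAt_indicator_ball hx.1 h1).fderiv
    have h3 : (a * b) x = ENNReal.ofReal (v x ^ (k * (γ - 1)) *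
        (k * v x ^ (k - 1) * √(gradSq n v x))) := by
      rw [ENNReal.ofReal_mul (by positivity), ← ENNReal.ofReal_rpow_of_pos hvx]
      rfl
    rw [h2, h3, ← ENNReal.ofReal_mul (by linarith), ← ofReal_norm, norm_smul]
    refine ENNReal.ofReal_le_ofReal ?_
    have hm0 : 0 ≤ max (v x - ε) 0 := le_max_right _ _
    rw [Real.norm_of_nonneg (by positivity)]
    have h4 : max (v x - ε) 0 ^ (γ * k - 1) ≤ v x ^ (k * (γ - 1)) * v x ^ (k - 1) := by
      rw [← Real.rpow_add hvx, show k * (γ - 1) + (k - 1) = γ * k - 1 by ring]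
      exact Real.rpow_le_rpow hm0 (max_le (by linarith) hvx.le) (by linarith)
    calc γ * k * max (v x - ε) 0 ^ (γ * k - 1) * ‖fderiv ℝ v x‖
        ≤ γ * k * (v x ^ (k * (γ - 1)) * v x ^ (k - 1)) * √(gradSq n v x) := by
          gcongr
          exact norm_fderiv_le_sqrt_gradSq n v x
      _ = _ := by ring
  have hout : ∀ x ∉ K, fderiv ℝ (truncPow n R ε (γ * k) v) x = 0 := by
    intro x hx
    refine fderiv_eq_zero_of_notMem hKc.isClosed (fun y hy => ?_) hx
    by_cases hyB : y ∈ B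
    · have : v y < ε := by
        by_contra! hlt
        exact hy ⟨hyB, hlt⟩
      rw [truncPow, Set.indicator_of_mem hyB, max_eq_right (by linarith),
        Real.zero_rpow (by linarith)]
    · rw [truncPow, Set.indicator_of_notMem hyB]
  have hvK : ContinuousOn v K := hvc.mono (hKB.trans Metric.ball_subset_closedBall)
  have hGK : ContinuousOn (gradSq n v) K := by
    refine continuousOn_finsetSum _ fun i _ => ?_
    exact (((hv2.continuousOn_fderiv_of_isOpen Metric.isOpen_ball (by norm_num)).mono
      hKB).clm_apply continuousOn_const).pow 2
  have ha : AEMeasurable a (volume.restrict K) :=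
    (hvK.aemeasurable hKc.isClosed.measurableSet).ennreal_ofReal.pow_const _
  have hb : AEMeasurable b (volume.restrict K) := by
    refine (ContinuousOn.aemeasurable ?_ hKc.isClosed.measurableSet).ennreal_ofReal
    exact ((hvK.rpow_const fun x _ => Or.inr (by linarith)).const_mul k).mul hGK.sqrt
  have ha2 : ∫⁻ x in K, a x ^ (2 : ℝ) ≤ ∫⁻ x in B, ENNReal.ofReal (v x) ^ (k * (2 * γ - 2)) := by
    refine (lintegral_mono_set hKB).trans (lintegral_mono fun x => ?_)
    simp only [a]
    rw [← ENNReal.rpow_mul, show k * (γ - 1) * 2 = k * (2 * γ - 2) by ring]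
  have hb2 : ∫⁻ x in K, b x ^ (2 : ℝ) ≤
      ENNReal.ofReal d * ∫⁻ x in B, ENNReal.ofReal (v x) ^ r := by
    have hm : 0 < p + r - 1 := by linarith
    calc ∫⁻ x in K, b x ^ (2 : ℝ)
        = ∫⁻ x in K, ENNReal.ofReal (k ^ 2 / (p + r - 1)) *
          ENNReal.ofReal ((p + r - 1) * v x ^ (p + r - 2) * gradSq n v x) := by
          refine setLIntegral_congr_fun hKc.isClosed.measurableSet fun x hx => ?_
          have hvx := hpos x hx.1
          simp only [b]
          rw [ENNReal.ofReal_rpow_of_nonneg (by positivity) (by norm_num),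
            ← ENNReal.ofReal_mul (by positivity)]
          congr 1
          rw [Real.rpow_two, mul_pow, mul_pow, Real.sq_sqrt (gradSq_nonneg n v x),
            ← Real.rpow_natCast (v x ^ (k - 1)), ← Real.rpow_mul hvx.le,
            show (k - 1) * ((2 : ℕ) : ℝ) = p + r - 2 by push_cast; linarith]
          field_simp
      _ = ENNReal.ofReal (k ^ 2 / (p + r - 1)) * ∫⁻ x in K,
          ENNReal.ofReal ((p + r - 1) * v x ^ (p + r - 2) * gradSq n v x) :=
          lintegral_const_mul' _ _ ENNReal.ofReal_ne_top
      _ ≤ ENNReal.ofReal (k ^ 2 / (p + r - 1)) * ∫⁻ x in B, ENNReal.ofReal (c * v x ^ r) := by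
          refine mul_le_mul' le_rfl ?_
          exact lintegral_gradSq_le hε hp hr hc hvc hv2 hpos hv0 hlap
      _ = ENNReal.ofReal (k ^ 2 / (p + r - 1)) * (ENNReal.ofReal c *
          ∫⁻ x in B, ENNReal.ofReal (v x) ^ r) := by
          rw [← lintegral_const_mul' (ENNReal.ofReal c) _ ENNReal.ofReal_ne_top]
          congr 1
          refine setLIntegral_congr_fun Metric.isOpen_ball.measurableSet fun x hx => ?_
          rw [ENNReal.ofReal_mul hc, ENNReal.ofReal_rpow_of_pos (hpos x hx)]
      _ ≤ _ := by
          rw [← mul_assoc, ← ENNReal.ofReal_mul (by positivity)]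
          gcongr
          rw [div_mul_eq_mul_div, div_le_iff₀ hm]
          linarith
  calc _ = ∫⁻ x in K, ‖fderiv ℝ (truncPow n R ε (γ * k) v) x‖ₑ := by
        rw [← lintegral_indicator hKc.isClosed.measurableSet]
        refine lintegral_congr fun x => ?_
        by_cases hx : x ∈ K
        · rw [Set.indicator_of_mem hx]
        · rw [Set.indicator_of_notMem hx, ← ofReal_norm, hout x hx, norm_zero, ENNReal.ofReal_zero]
    _ ≤ ∫⁻ x in K, ENNReal.ofReal γ * (a * b) x :=
        setLIntegral_mono' hKc.isClosed.measurableSet hpt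
    _ = ENNReal.ofReal γ * ∫⁻ x in K, (a * b) x :=
        lintegral_const_mul' _ _ ENNReal.ofReal_ne_top
    _ ≤ ENNReal.ofReal γ * ((∫⁻ x in K, a x ^ (2 : ℝ)) ^ (1 / 2 : ℝ) *
          (∫⁻ x in K, b x ^ (2 : ℝ)) ^ (1 / 2 : ℝ)) := by
        gcongr
        exact ENNReal.lintegral_mul_le_Lp_mul_Lq _ Real.HolderConjugate.two_two ha hb
    _ ≤ _ := by
        gcongr

theorem exists_sobolev_const (n : ℕ) (hn : 2 ≤ n) :
    ∃ C : ℝ, 0 < C ∧ ∀ f : Euc n → ℝ, ContDiff ℝ 1 f → HasCompactSupport f →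
      (∫⁻ x, ‖f x‖ₑ ^ ((n : ℝ) / (n - 1))) ≤
        (ENNReal.ofReal C * ∫⁻ x, ‖fderiv ℝ f x‖ₑ) ^ ((n : ℝ) / (n - 1)) := by
  have hn1 : (1 : ℝ) < n := by exact_mod_cast (by omega : 1 < n)
  have hconj : Real.HolderConjugate (Module.finrank ℝ (Euc n)) ((n : ℝ) / (n - 1)) := by
    rw [finrank_euclideanSpace_fin]
    exact Real.HolderConjugate.conjExponent hn1
  refine ⟨lintegralPowLePowLIntegralFDerivConst (volume : Measure (Euc n)) ((n : ℝ) / (n - 1)) ^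
    ((n : ℝ) / (n - 1))⁻¹ + 1, by positivity, fun f hf hc => ?_⟩
  have hq : 0 < (n : ℝ) / (n - 1) := div_pos (by linarith) (by linarith)
  refine (lintegral_pow_le_pow_lintegral_fderiv volume hf hc hconj).trans ?_
  rw [ENNReal.mul_rpow_of_nonneg _ _ hq.le]
  gcongr
  rw [ENNReal.ofReal_rpow_of_nonneg (by positivity) hq.le, ← ENNReal.ofReal_coe_nnreal]
  refine ENNReal.ofReal_le_ofReal ?_
  calc ((lintegralPowLePowLIntegralFDerivConst (volume : Measure (Euc n)) ((n : ℝ) / (n - 1)) :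
        NNReal) : ℝ)
      = (((lintegralPowLePowLIntegralFDerivConst (volume : Measure (Euc n)) ((n : ℝ) / (n - 1)) :
        NNReal) : ℝ) ^ ((n : ℝ) / (n - 1))⁻¹) ^ ((n : ℝ) / (n - 1)) :=
        (Real.rpow_inv_rpow (by positivity) hq.ne').symm
    _ ≤ _ := by
        gcongr
        linarith

theorem sobolev_power_le {n : ℕ} {R p r c k γ d q C : ℝ} {v : Euc n → ℝ}
    (hp : 1 ≤ p) (hr : 1 ≤ r) (hc : 0 ≤ c) (hk : k = (p + r) / 2) (hγ : 2 ≤ γ)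
    (hd : k ^ 2 * c ≤ (p + r - 1) * d) (hq : 0 < q)
    (hsob : ∀ f : Euc n → ℝ, ContDiff ℝ 1 f → HasCompactSupport f →
      (∫⁻ x, ‖f x‖ₑ ^ q) ≤ (ENNReal.ofReal C * ∫⁻ x, ‖fderiv ℝ f x‖ₑ) ^ q)
    (hvc : ContinuousOn v (Metric.closedBall 0 R))
    (hv2 : ContDiffOn ℝ 2 v (Metric.ball 0 R))
    (hpos : ∀ x ∈ Metric.ball (0 : Euc n) R, 0 < v x)
    (hv0 : ∀ x ∈ Metric.sphere (0 : Euc n) R, v x = 0)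
    (hlap : ∀ x ∈ Metric.ball (0 : Euc n) R, -(c * v x) ≤ v x ^ p * lap n v x) :
    ∫⁻ x in Metric.ball (0 : Euc n) R, ENNReal.ofReal (v x) ^ (k * (γ * q)) ≤
      (ENNReal.ofReal C * (ENNReal.ofReal γ *
        ((∫⁻ x in Metric.ball (0 : Euc n) R, ENNReal.ofReal (v x) ^ (k * (2 * γ - 2))) ^ (1 / 2 : ℝ) *
        (ENNReal.ofReal d *
          ∫⁻ x in Metric.ball (0 : Euc n) R, ENNReal.ofReal (v x) ^ r) ^ (1 / 2 : ℝ)))) ^ q := by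
  have hβ : 1 < γ * k := by nlinarith
  have hε : ∀ j : ℕ, 0 < 1 / ((j : ℝ) + 1) := fun j => by positivity
  have hf := fun j => contDiff_truncPow (hε j) hβ hvc hv2 hv0
  calc _ = ∫⁻ x in Metric.ball (0 : Euc n) R, Filter.liminf
          (fun j : ℕ => ‖truncPow n R (1 / ((j : ℝ) + 1)) (γ * k) v x‖ₑ ^ q) Filter.atTop := by
        refine setLIntegral_congr_fun Metric.isOpen_ball.measurableSet fun x hx => ?_
        have h1 := ((ENNReal.continuous_rpow_const (y := q)).tendsto _).comp
          (tendsto_truncPow hβ hx (hpos x hx))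
        rw [show k * (γ * q) = γ * k * q by ring, ENNReal.rpow_mul]
        exact h1.liminf_eq.symm
    _ ≤ Filter.liminf (fun j : ℕ => ∫⁻ x in Metric.ball (0 : Euc n) R,
          ‖truncPow n R (1 / ((j : ℝ) + 1)) (γ * k) v x‖ₑ ^ q) Filter.atTop :=
        lintegral_liminf_le fun j =>
          (hf j).1.continuous.measurable.enorm.pow_const q
    _ ≤ _ := by
        refine Filter.liminf_le_of_le (by isBoundedDefault) fun b hb => ?_
        obtain ⟨j, hj⟩ := hb.exists
        refine hj.trans ((lintegral_mono' Measure.restrict_le_self le_rfl).trans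
          ((hsob _ (hf j).1 (hf j).2).trans ?_))
        gcongr
        exact lintegral_fderiv_truncPow_le (hε j) hp hr hc hk hγ hd hvc hv2 hpos hv0 hlap

theorem sup_power_le {R p r c k d : ℝ} {v : Euc 1 → ℝ}
    (hp : 1 ≤ p) (hr : 1 ≤ r) (hc : 0 ≤ c) (hk : k = (p + r) / 2)
    (hd : k ^ 2 * c ≤ (p + r - 1) * d)
    (hvc : ContinuousOn v (Metric.closedBall 0 R))
    (hv2 : ContDiffOn ℝ 2 v (Metric.ball 0 R))
    (hpos : ∀ x ∈ Metric.ball (0 : Euc 1) R, 0 < v x)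
    (hv0 : ∀ x ∈ Metric.sphere (0 : Euc 1) R, v x = 0)
    (hlap : ∀ x ∈ Metric.ball (0 : Euc 1) R, -(c * v x) ≤ v x ^ p * lap 1 v x)
    {x : Euc 1} (hx : x ∈ Metric.ball (0 : Euc 1) R) :
    ENNReal.ofReal (v x) ^ (2 * k) ≤
      ENNReal.ofReal 2 *
        ((∫⁻ x in Metric.ball (0 : Euc 1) R, ENNReal.ofReal (v x) ^ (k * 2)) ^ (1 / 2 : ℝ) *
        (ENNReal.ofReal d *
          ∫⁻ x in Metric.ball (0 : Euc 1) R, ENNReal.ofReal (v x) ^ r) ^ (1 / 2 : ℝ)) := by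
  have hβ : 1 < 2 * k := by linarith
  have hε : ∀ j : ℕ, 0 < 1 / ((j : ℝ) + 1) := fun j => by positivity
  have hf := fun j => contDiff_truncPow (hε j) hβ hvc hv2 hv0
  refine le_of_tendsto' (tendsto_truncPow hβ hx (hpos x hx)) fun j => ?_
  refine (enorm_le_lintegral_fderiv (hf j).1 (hf j).2 x).trans ?_
  refine (lintegral_fderiv_truncPow_le (hε j) hp hr hc hk le_rfl hd hvc hv2 hpos hv0 hlap).trans ?_
  rw [show (2 : ℝ) * 2 - 2 = 2 by norm_num]

theorem exists_lintegral_rpow_eq_exp {n : ℕ} {R : ℝ} {v : Euc n → ℝ} (hR : 0 < R)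
    (hvc : ContinuousOn v (Metric.closedBall 0 R))
    (hpos : ∀ x ∈ Metric.ball (0 : Euc n) R, 0 < v x) {m : ℝ} (hm : 0 ≤ m) :
    ∃ g : ℝ, ∫⁻ x in Metric.ball (0 : Euc n) R, ENNReal.ofReal (v x) ^ m =
      ENNReal.ofReal (Real.exp g) := by
  have hB := Metric.isOpen_ball (x := (0 : Euc n)) (ε := R) |>.measurableSet
  have hmeas : AEMeasurable (fun x => ENNReal.ofReal (v x) ^ m)
      (volume.restrict (Metric.ball (0 : Euc n) R)) :=
    ((hvc.mono Metric.ball_subset_closedBall).aemeasurable hB).ennreal_ofReal.pow_const _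
  have h0 : ∫⁻ x in Metric.ball (0 : Euc n) R, ENNReal.ofReal (v x) ^ m ≠ 0 := by
    intro h
    rw [lintegral_eq_zero_iff' hmeas] at h
    have h1 : ∀ᵐ x ∂(volume.restrict (Metric.ball (0 : Euc n) R)), False := by
      filter_upwards [h, ae_restrict_mem hB] with x hx hxB
      have := ENNReal.rpow_pos (p := m) (ENNReal.ofReal_pos.2 (hpos x hxB)) ENNReal.ofReal_ne_top
      exact this.ne' hx
    have h2 : volume (Metric.ball (0 : Euc n) R) = 0 := by
      have := Filter.eventually_false_iff_eq_bot.1 h1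
      rwa [ae_eq_bot, Measure.restrict_eq_zero] at this
    exact (Metric.measure_ball_pos volume (0 : Euc n) hR).ne' h2
  have ht : ∫⁻ x in Metric.ball (0 : Euc n) R, ENNReal.ofReal (v x) ^ m ≠ ∞ := by
    obtain ⟨A, hA⟩ := (isCompact_closedBall (0 : Euc n) R).bddAbove_image hvc
    refine ((setLIntegral_mono' (g := fun _ => ENNReal.ofReal A ^ m) hB
      fun x hx => ?_).trans_lt ?_).ne (b := ∞)
    · gcongr
      exact hA (Set.mem_image_of_mem v (Metric.ball_subset_closedBall hx))
    · rw [setLIntegral_const]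
      exact ENNReal.mul_lt_top (ENNReal.rpow_lt_top_of_nonneg hm ENNReal.ofReal_ne_top)
        measure_ball_lt_top
  refine ⟨Real.log (∫⁻ x in Metric.ball (0 : Euc n) R, ENNReal.ofReal (v x) ^ m).toReal, ?_⟩
  rw [Real.exp_log (ENNReal.toReal_pos h0 ht), ENNReal.ofReal_toReal ht]

theorem ofReal_exp_rpow (g y : ℝ) :
    ENNReal.ofReal (Real.exp g) ^ y = ENNReal.ofReal (Real.exp (g * y)) := by
  rw [ENNReal.ofReal_rpow_of_pos (Real.exp_pos _), Real.exp_mul]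

theorem ofReal_exp_mul (a b : ℝ) :
    ENNReal.ofReal (Real.exp a) * ENNReal.ofReal (Real.exp b) = ENNReal.ofReal (Real.exp (a + b)) := by
  rw [← ENNReal.ofReal_mul (Real.exp_pos _).le, Real.exp_add]

theorem ofReal_exp_le_iff {a b : ℝ} :
    ENNReal.ofReal (Real.exp a) ≤ ENNReal.ofReal (Real.exp b) ↔ a ≤ b := by
  rw [ENNReal.ofReal_le_ofReal_iff (Real.exp_pos _).le, Real.exp_le_exp]

/-- Logarithmic convexity of `m ↦ ∫ v ^ m`. -/
theorem log_convex_lintegral_rpow {n : ℕ} {R k a b m ga gb gm : ℝ} {v : Euc n → ℝ}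
    (hvc : ContinuousOn v (Metric.closedBall 0 R))
    (hpos : ∀ x ∈ Metric.ball (0 : Euc n) R, 0 < v x) (ham : a ≤ m) (hmb : m ≤ b) (hab : a < b)
    (ha : ∫⁻ x in Metric.ball (0 : Euc n) R, ENNReal.ofReal (v x) ^ (k * a) =
      ENNReal.ofReal (Real.exp ga))
    (hb : ∫⁻ x in Metric.ball (0 : Euc n) R, ENNReal.ofReal (v x) ^ (k * b) =
      ENNReal.ofReal (Real.exp gb))
    (hm : ∫⁻ x in Metric.ball (0 : Euc n) R, ENNReal.ofReal (v x) ^ (k * m) =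
      ENNReal.ofReal (Real.exp gm)) :
    (b - a) * gm ≤ (b - m) * ga + (m - a) * gb := by
  have hB := Metric.isOpen_ball (x := (0 : Euc n)) (ε := R) |>.measurableSet
  have hba : 0 < b - a := by linarith
  have hmeas : ∀ m : ℝ, AEMeasurable (fun x => ENNReal.ofReal (v x) ^ m)
      (volume.restrict (Metric.ball (0 : Euc n) R)) := fun m =>
    ((hvc.mono Metric.ball_subset_closedBall).aemeasurable hB).ennreal_ofReal.pow_const _
  have h := ENNReal.lintegral_mul_norm_pow_le (hmeas (k * a)) (hmeas (k * b))
    (p := (b - m) / (b - a)) (q := (m - a) / (b - a)) (div_nonneg (by linarith) hba.le)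
    (div_nonneg (by linarith) hba.le) (by field_simp; ring)
  have heq : ∫⁻ x in Metric.ball (0 : Euc n) R, (ENNReal.ofReal (v x) ^ (k * a)) ^ ((b - m) / (b - a)) *
      (ENNReal.ofReal (v x) ^ (k * b)) ^ ((m - a) / (b - a)) =
      ∫⁻ x in Metric.ball (0 : Euc n) R, ENNReal.ofReal (v x) ^ (k * m) := by
    refine setLIntegral_congr_fun hB fun x hx => ?_
    rw [← ENNReal.rpow_mul, ← ENNReal.rpow_mul, ← ENNReal.rpow_add _ _
      (ENNReal.ofReal_pos.2 (hpos x hx)).ne' ENNReal.ofReal_ne_top]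
    congr 1
    field_simp
    ring
  rw [heq, ha, hb, hm, ofReal_exp_rpow, ofReal_exp_rpow, ofReal_exp_mul, ofReal_exp_le_iff] at h
  have := mul_le_mul_of_nonneg_left h hba.le
  field_simp at this
  linarith

theorem lintegral_rpow_le_of_sup_le {n : ℕ} {R k a b μ ga gb : ℝ} {v : Euc n → ℝ}
    (hpos : ∀ x ∈ Metric.ball (0 : Euc n) R, 0 < v x) (hab : a ≤ b)
    (hsup : ∀ x ∈ Metric.ball (0 : Euc n) R,
      ENNReal.ofReal (v x) ^ (2 * k) ≤ ENNReal.ofReal (Real.exp (2 * μ)))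
    (ha : ∫⁻ x in Metric.ball (0 : Euc n) R, ENNReal.ofReal (v x) ^ (k * a) =
      ENNReal.ofReal (Real.exp ga))
    (hb : ∫⁻ x in Metric.ball (0 : Euc n) R, ENNReal.ofReal (v x) ^ (k * b) =
      ENNReal.ofReal (Real.exp gb)) :
    gb ≤ (b - a) * μ + ga := by
  rw [← ofReal_exp_le_iff, ← ofReal_exp_mul, ← ha, ← hb,
    ← lintegral_const_mul' _ _ ENNReal.ofReal_ne_top]
  refine setLIntegral_mono' Metric.isOpen_ball.measurableSet fun x hx => ?_
  have hx0 : ENNReal.ofReal (v x) ≠ 0 := (ENNReal.ofReal_pos.2 (hpos x hx)).ne'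
  have h1 := ENNReal.rpow_le_rpow (hsup x hx) (show 0 ≤ (b - a) / 2 by linarith)
  rw [← ENNReal.rpow_mul, ofReal_exp_rpow] at h1
  calc ENNReal.ofReal (v x) ^ (k * b)
      = ENNReal.ofReal (v x) ^ (2 * k * ((b - a) / 2)) * ENNReal.ofReal (v x) ^ (k * a) := by
        rw [← ENNReal.rpow_add _ _ hx0 ENNReal.ofReal_ne_top]
        congr 1
        ring
    _ ≤ _ := by
        rw [show (b - a) * μ = 2 * μ * ((b - a) / 2) by ring]
        gcongr

theorem interpolation_exponent_bound {ν s q γ c ℓ gq gs gS gM : ℝ} (hν : 1 < ν) (hq : 0 < q)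
    (hq2 : q < 2) (hqs : q < γ * (ν / (ν - 1))) (hs : q ≤ s)
    (h1 : (γ * (ν / (ν - 1)) - q) * gM ≤
      (γ * (ν / (ν - 1)) - (2 * γ - 2)) * gq + ((2 * γ - 2) - q) * gS)
    (h2 : (γ * (ν / (ν - 1)) - q) * gs ≤ (γ * (ν / (ν - 1)) - s) * gq + (s - q) * gS)
    (h3 : gS ≤ (c + (gM * (1 / 2) + (ℓ + gq) * (1 / 2))) * (ν / (ν - 1))) :
    2 * (1 + q / ν - q / 2) * gs ≤ (s - q) * (2 * c + ℓ + gq) + (2 + 2 * s / ν - s) * gq := by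
  have hν1 : 0 < ν - 1 := by linarith
  have hν0 : 0 < ν := by linarith
  obtain ⟨S, hS⟩ : ∃ S, S = γ * (ν / (ν - 1)) := ⟨_, rfl⟩
  obtain ⟨i, hi⟩ : ∃ i, i = 1 / ν := ⟨_, rfl⟩
  have hi0 : 0 < i := by rw [hi]; positivity
  have hi1 : i < 1 := by rw [hi, div_lt_one hν0]; exact hν
  have hconj : ν / (ν - 1) = 1 / (1 - i) := by
    have : (1 - 1 / ν) ≠ 0 := by rw [← hi]; linarith
    rw [hi]; field_simp
  have hγ : γ = S * (1 - i) := by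
    rw [hS, hconj]; field_simp [(by linarith : (1 - i) ≠ 0)]
  rw [← hS] at h1 h2 hqs
  have h3' : (1 - i) * gS ≤ c + (gM * (1 / 2) + (ℓ + gq) * (1 / 2)) := by
    rw [hconj, mul_one_div, le_div_iff₀ (by linarith)] at h3
    linarith
  have e1 : q / ν = q * i := by rw [hi]; ring
  have e2 : 2 * s / ν = 2 * s * i := by rw [hi]; ring
  rw [e1, e2]
  have hD : 0 < S - q := by linarith
  have h4 : 2 * (1 + q * i - q / 2) * gS ≤
      (S - q) * (2 * c + ℓ + gq) + (S - (2 * γ - 2)) * gq := by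
    have := mul_le_mul_of_nonneg_left h3' hD.le
    rw [hγ] at h1 ⊢
    nlinarith [this, h1]
  have hN : 0 < 1 + q * i - q / 2 := by nlinarith
  have h5 := mul_le_mul_of_nonneg_left h2 (by linarith : 0 ≤ 2 * (1 + q * i - q / 2))
  have h6 := mul_le_mul_of_nonneg_left h4 (by linarith : 0 ≤ s - q)
  refine le_of_mul_le_mul_left ?_ hD
  rw [hγ] at h6
  nlinarith [h5, h6]

theorem final_exponent_bound {ν s k p r L gq gs : ℝ} (hν : 1 ≤ ν) (hp : 1 ≤ p) (hr : 1 ≤ r)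
    (hs : 2 < s) (hk : k = (p + r) / 2)
    (h : 2 * (1 + r / k / ν - r / k / 2) * gs ≤
      (s - r / k) * (L + gq) + (2 + 2 * s / ν - s) * gq) :
    gs * (1 / (k * s)) ≤
      L * ((ν * (p + r) / (2 * r) - ν / s) / (1 - ν / 2 + ν * (p + r) / (2 * r)) / (p + r)) +
      gq * (1 / r) *
        (1 - p * ((ν * (p + r) / (2 * r) - ν / s) / (1 - ν / 2 + ν * (p + r) / (2 * r))) / (p + r)) := by
  have hk0 : 0 < k := by linarith
  have hN : 0 < 1 + r / k / ν - r / k / 2 := by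
    have h1 : r / k / 2 < 1 := by rw [div_div, div_lt_one (by positivity)]; linarith
    have h2 : 0 < r / k / ν := by positivity
    linarith
  obtain ⟨q, hq⟩ : ∃ q, q = r / k := ⟨_, rfl⟩
  have hq0 : 0 < q := by rw [hq]; positivity
  have hrq : r = q * k := by rw [hq]; field_simp
  rw [← hq] at h hN
  have hpq : p = k * (2 - q) := by linarith
  have hpr : p + r = 2 * k := by linarith
  have ha : (ν * (p + r) / (2 * r) - ν / s) / (1 - ν / 2 + ν * (p + r) / (2 * r)) =
      (s - q) / (s * (1 + q / ν - q / 2)) := by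
    have e : ν * (p + r) / (2 * r) = ν / q := by rw [hpr, hrq]; field_simp
    have e2 : 1 - ν / 2 + ν / q = (1 + q / ν - q / 2) * (ν / q) := by field_simp; ring
    rw [e, e2]
    have hN' := hN.ne'
    generalize (1 + q / ν - q / 2) = N at *
    field_simp
  rw [ha, hpr, hpq, hrq]
  have key : 0 ≤ ((s - q) * (L + gq) + (2 + 2 * s / ν - s) * gq - 2 * (1 + q / ν - q / 2) * gs) /
      (2 * (1 + q / ν - q / 2) * k * s) := div_nonneg (by linarith) (by positivity)
  rw [← sub_nonneg]
  refine key.trans_eq ?_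
  obtain ⟨N, hNd⟩ : ∃ N, N = 1 + q / ν - q / 2 := ⟨_, rfl⟩
  rw [← hNd] at hN ⊢
  have e3 : 2 * s / ν = 2 * s * ((N - 1 + q / 2) / q) := by rw [hNd]; field_simp; ring
  rw [e3]
  field_simp
  ring

/-- The logarithmic form of the iteration estimate: `g m` stands for `log ∫ v ^ (k m)`. -/
theorem exists_const_log_bound (n : ℕ) (hn : 1 ≤ n) (s : ℝ) (hs : 2 < s)
    (hs2 : ((n : ℝ) - 2) * s < 2 * n) :
    ∃ C : ℝ, 0 < C ∧ ∀ (R p r c k d gq gs : ℝ) (v : Euc n → ℝ), 0 < R → 1 ≤ p → 1 ≤ r → 0 ≤ c →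
      k = (p + r) / 2 → 0 < d → k ^ 2 * c ≤ (p + r - 1) * d →
      ContinuousOn v (Metric.closedBall 0 R) →
      ContDiffOn ℝ 2 v (Metric.ball 0 R) →
      (∀ x ∈ Metric.ball (0 : Euc n) R, 0 < v x) →
      (∀ x ∈ Metric.sphere (0 : Euc n) R, v x = 0) →
      (∀ x ∈ Metric.ball (0 : Euc n) R, -(c * v x) ≤ v x ^ p * lap n v x) →
      ∫⁻ x in Metric.ball (0 : Euc n) R, ENNReal.ofReal (v x) ^ r =
        ENNReal.ofReal (Real.exp gq) →
      ∫⁻ x in Metric.ball (0 : Euc n) R, ENNReal.ofReal (v x) ^ (k * s) =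
        ENNReal.ofReal (Real.exp gs) →
      2 * (1 + r / k / n - r / k / 2) * gs ≤
        (s - r / k) * (Real.log (C * d) + gq) + (2 + 2 * s / n - s) * gq := by
  rcases hn.eq_or_lt with rfl | hn2
  · refine ⟨4, by norm_num, ?_⟩
    intro R p r c k d gq gs v hR hp hr hc hk hd hkd hvc hv2 hpos hv0 hlap hgq hgs
    have hk0 : 0 < k := by linarith
    have hkq : k * (r / k) = r := by field_simp
    have hq0 : 0 < r / k := by positivity
    have hq2 : r / k < 2 := by rw [div_lt_iff₀ hk0]; linarith
    obtain ⟨g2, hg2⟩ := exists_lintegral_rpow_eq_exp hR hvc hpos (m := k * 2) (by positivity)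
    have hsup := fun x hx => sup_power_le hp hr hc hk hkd hvc hv2 hpos hv0 hlap (x := x) hx
    rw [hg2, hgq, ← Real.exp_log hd, ← Real.exp_log (zero_lt_two' ℝ)] at hsup
    simp only [ofReal_exp_mul, ofReal_exp_rpow] at hsup
    rw [Real.exp_log (zero_lt_two' ℝ)] at hsup
    obtain ⟨μ, hμ⟩ : ∃ μ, 2 * μ = Real.log 2 + (g2 * (1 / 2) + (Real.log d + gq) * (1 / 2)) :=
      ⟨(Real.log 2 + (g2 * (1 / 2) + (Real.log d + gq) * (1 / 2))) / 2, by ring⟩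
    rw [← hμ] at hsup
    rw [← hkq] at hgq
    have h2 := lintegral_rpow_le_of_sup_le hpos hq2.le hsup hgq hg2
    have h3 := lintegral_rpow_le_of_sup_le hpos (by linarith) hsup hgq hgs
    rw [Real.log_mul (by norm_num) hd.ne', show (4 : ℝ) = 2 ^ 2 by norm_num, Real.log_pow]
    push_cast
    generalize r / k = q at *
    have h4 : (2 + q) * μ ≤ 2 * Real.log 2 + Real.log d + gq + gq := by linarith
    have h5 := mul_le_mul_of_nonneg_left h3 (by linarith : 0 ≤ 2 + q)
    have h6 := mul_le_mul_of_nonneg_left h4 (by linarith : 0 ≤ s - q)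
    linarith
  · obtain ⟨A, hA, hsob⟩ := exists_sobolev_const n hn2
    have hν : (1 : ℝ) < n := by exact_mod_cast hn2
    have hν1 : (0 : ℝ) < n - 1 := by linarith
    obtain ⟨γ, hγ⟩ : ∃ γ : ℝ, γ = max (s * ((n - 1) / n)) 2 := ⟨_, rfl⟩
    have hγ2 : 2 ≤ γ := hγ ▸ le_max_right _ _
    have hγs : s ≤ γ * (n / (n - 1)) := by
      have : s * ((n - 1) / n) ≤ γ := hγ ▸ le_max_left _ _
      calc s = s * ((n - 1) / n) * (n / (n - 1)) := by field_simp
        _ ≤ _ := by gcongr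
    have hγM : 2 * γ - 2 ≤ γ * (n / (n - 1)) := by
      rw [← mul_div_assoc, le_div_iff₀ hν1]
      have : γ * (n - 2) ≤ 2 * (n - 1) := by
        rcases max_choice (s * (((n : ℝ) - 1) / n)) 2 with h | h
        · rw [hγ, h]
          have : s * (((n : ℝ) - 1) / n) * (n - 2) = (n - 2) * s * ((n - 1) / n) := by ring
          rw [this]
          calc ((n : ℝ) - 2) * s * ((n - 1) / n) ≤ 2 * n * ((n - 1) / n) := by gcongr
            _ = _ := by field_simp
        · rw [hγ, h]; linarith
      linarith
    refine ⟨(A * γ) ^ 2, by positivity, ?_⟩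
    intro R p r c k d gq gs v hR hp hr hc hk hd hkd hvc hv2 hpos hv0 hlap hgq hgs
    have hk0 : 0 < k := by linarith
    have hγ0 : 0 < γ := by linarith
    have hkq : k * (r / k) = r := by field_simp
    have hq0 : 0 < r / k := by positivity
    have hq2 : r / k < 2 := by rw [div_lt_iff₀ hk0]; linarith
    obtain ⟨gM, hgM⟩ := exists_lintegral_rpow_eq_exp hR hvc hpos (m := k * (2 * γ - 2))
      (mul_nonneg hk0.le (by linarith))
    obtain ⟨gS, hgS⟩ := exists_lintegral_rpow_eq_exp hR hvc hpos (m := k * (γ * (n / (n - 1))))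
      (by positivity)
    have h3 := sobolev_power_le hp hr hc hk hγ2 hkd (by positivity) hsob hvc hv2 hpos hv0 hlap
    rw [hgM, hgS, hgq, ← mul_assoc, ← ENNReal.ofReal_mul hA.le, ← Real.exp_log hd,
      ← Real.exp_log (mul_pos hA hγ0)] at h3
    simp only [ofReal_exp_mul, ofReal_exp_rpow, ofReal_exp_le_iff] at h3
    rw [← hkq] at hgq
    have h1 := log_convex_lintegral_rpow hvc hpos (by linarith) hγM (by linarith) hgq hgS hgM
    have h2 := log_convex_lintegral_rpow hvc hpos (by linarith) hγs (by linarith) hgq hgS hgs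
    have := interpolation_exponent_bound hν hq0 hq2 (by linarith) (by linarith) h1 h2 h3
    rw [Real.log_mul (by positivity) hd.ne', Real.log_pow]
    exact_mod_cast this

theorem eLpNorm_eq_of_lintegral_eq_exp {n : ℕ} {R m g : ℝ} {v : Euc n → ℝ} (hm : 0 < m)
    (hpos : ∀ x ∈ Metric.ball (0 : Euc n) R, 0 < v x)
    (hg : ∫⁻ x in Metric.ball (0 : Euc n) R, ENNReal.ofReal (v x) ^ m =
      ENNReal.ofReal (Real.exp g)) :
    eLpNorm v (ENNReal.ofReal m) (volume.restrict (Metric.ball (0 : Euc n) R)) =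
      ENNReal.ofReal (Real.exp (g * (1 / m))) := by
  rw [eLpNorm_eq_lintegral_rpow_enorm_toReal (ENNReal.ofReal_pos.2 hm).ne' ENNReal.ofReal_ne_top,
    ENNReal.toReal_ofReal hm.le, ← ofReal_exp_rpow, ← hg]
  congr 1
  refine setLIntegral_congr_fun Metric.isOpen_ball.measurableSet fun x hx => ?_
  rw [Real.enorm_of_nonneg (hpos x hx).le]

/-- Lemma (iteration step): there is `C = C(n,p,s) > 0` such that every positive classical
solution of `∂ₜ u = uᵖ Δu` in `B_R × (0,∞)` vanishing on `∂B_R` and satisfying the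
semi-convexity estimate `∂ₜ u ≥ -u/(pt)` obeys
`‖u(·,t)‖_{L^{(p+r)s/2}(B_R)} ≤ (Cr/t)^{a/(p+r)} ‖u(·,t)‖_{L^r(B_R)}^{1-pa/(p+r)}`
for all `r ≥ 1` and `t > 1`, with
`a = (n(p+r)/(2r) - n/s)/(1 - n/2 + n(p+r)/(2r))`. -/
theorem stmt15 (n : ℕ) (hn : 1 ≤ n) (p s : ℝ) (hp : 1 ≤ p) (hs : 2 < s)
    (hs2 : ((n : ℝ) - 2) * s < 2 * n) :
    ∃ C : ℝ, 0 < C ∧ ∀ R : ℝ, 0 < R → ∀ r : ℝ, 1 ≤ r → ∀ t : ℝ, 1 < t →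
      ∀ u : Euc n → ℝ → ℝ,
      ContinuousOn (fun q : Euc n × ℝ => u q.1 q.2)
        (Metric.closedBall (0 : Euc n) R ×ˢ Set.Ici (0 : ℝ)) →
      (∀ τ : ℝ, 0 < τ → ContDiffOn ℝ 2 (fun x => u x τ) (Metric.ball (0 : Euc n) R)) →
      (∀ x ∈ Metric.ball (0 : Euc n) R, ∀ τ : ℝ, 0 < τ → DifferentiableAt ℝ (u x) τ) →
      (∀ x ∈ Metric.ball (0 : Euc n) R, ∀ τ : ℝ, 0 < τ → 0 < u x τ) →
      (∀ x ∈ Metric.ball (0 : Euc n) R, ∀ τ : ℝ, 0 < τ →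
        deriv (u x) τ = u x τ ^ p * lap n (fun y => u y τ) x) →
      (∀ x ∈ Metric.sphere (0 : Euc n) R, ∀ τ : ℝ, 0 < τ → u x τ = 0) →
      (∀ x ∈ Metric.ball (0 : Euc n) R, ∀ τ : ℝ, 0 < τ →
        -(u x τ) / (p * τ) ≤ deriv (u x) τ) →
      eLpNorm (fun x => u x t) (ENNReal.ofReal ((p + r) * s / 2))
          (volume.restrict (Metric.ball (0 : Euc n) R)) ≤
        ENNReal.ofReal ((C * r / t) ^
            ((((n : ℝ) * (p + r) / (2 * r) - (n : ℝ) / s) /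
              (1 - (n : ℝ) / 2 + (n : ℝ) * (p + r) / (2 * r))) / (p + r))) *
          eLpNorm (fun x => u x t) (ENNReal.ofReal r)
              (volume.restrict (Metric.ball (0 : Euc n) R)) ^
            (1 - p * (((n : ℝ) * (p + r) / (2 * r) - (n : ℝ) / s) /
              (1 - (n : ℝ) / 2 + (n : ℝ) * (p + r) / (2 * r))) / (p + r)) := by
  obtain ⟨C, hC, hmain⟩ := exists_const_log_bound n hn s hs hs2
  refine ⟨C, hC, ?_⟩
  intro R hR r hr t ht u huc hu2 _ hupos heq hu0 hsemi
  have ht0 : 0 < t := by linarith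
  have hpr : 0 < p + r := by linarith
  have hvc : ContinuousOn (fun x => u x t) (Metric.closedBall (0 : Euc n) R) :=
    huc.comp (f := fun x => (x, t)) (by fun_prop) fun x hx => ⟨hx, ht0.le⟩
  have hpos : ∀ x ∈ Metric.ball (0 : Euc n) R, 0 < u x t := fun x hx => hupos x hx t ht0
  obtain ⟨gq, hgq⟩ := exists_lintegral_rpow_eq_exp hR hvc hpos (m := r) (by linarith)
  obtain ⟨gs, hgs⟩ := exists_lintegral_rpow_eq_exp hR hvc hpos (m := (p + r) / 2 * s)
    (by positivity)
  have hkd : ((p + r) / 2) ^ 2 * (1 / (p * t)) ≤ (p + r - 1) * (r / t) := by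
    have h1 : p + r ≤ 2 * (p + r - 1) := by linarith
    have h2 : p + r ≤ 2 * (p * r) := by nlinarith
    have h3 : (p + r) * (p + r) ≤ 2 * (p + r - 1) * (2 * (p * r)) :=
      mul_le_mul h1 h2 hpr.le (by linarith)
    rw [mul_one_div, div_le_iff₀ (by positivity)]
    have : (p + r - 1) * (r / t) * (p * t) = (p + r - 1) * (p * r) := by field_simp
    rw [this]
    linarith
  have hlog := hmain R p r (1 / (p * t)) ((p + r) / 2) (r / t) gq gs (fun x => u x t) hR hp hr
    (by positivity) rfl (by positivity) hkd hvc (hu2 t ht0) hpos (fun x hx => hu0 x hx t ht0)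
    (fun x hx => by
      rw [← heq x hx t ht0]
      refine le_trans (le_of_eq ?_) (hsemi x hx t ht0)
      ring) hgq hgs
  have hfin := final_exponent_bound (ν := (n : ℝ)) (by exact_mod_cast hn) hp hr hs rfl hlog
  rw [show (p + r) * s / 2 = (p + r) / 2 * s by ring,
    eLpNorm_eq_of_lintegral_eq_exp (by positivity) hpos hgs,
    eLpNorm_eq_of_lintegral_eq_exp (by linarith) hpos hgq,
    ← ENNReal.ofReal_rpow_of_pos (by positivity), mul_div_assoc C r t,
    ← Real.exp_log (show 0 < C * (r / t) by positivity), ofReal_exp_rpow, ofReal_exp_rpow,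
    ofReal_exp_mul, ofReal_exp_le_iff]
  exact hfin
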